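/- There exists a universal constant c* ≥ 1 such that for every smooth function f ∈ C^∞(𝕋²) with ∫_{𝕋²}|∇f| dx > 0 and every ε > 0 one has ∫_{𝕋²}|∇^{1/2}f|² dx ≤ (ε/2)∫_{𝕋²}|∇f|² dx + (2/π)·log( c* · max{1, min{ ‖f‖_∞/(ε ∫_{𝕋²}|∇f| dx), 1/ε }} ) · ‖f‖_∞ · ∫_{𝕋²}|∇f| dx. -/

import Mathlib

open MeasureTheory Real

noncomputable section

/-- The plane `ℝ²`, modeled as functions `Fin 2 → ℝ`. -/
abbrev R2 : Type := Fin 2 → ℝ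

/-- A fundamental domain for the unit torus `𝕋² = ℝ²/ℤ²`. -/
def cube : Set R2 := Set.univ.pi fun _ => Set.Ico (0 : ℝ) 1

/-- `ℤ²`-periodicity: functions on the torus `𝕋²`. -/
def Per (f : R2 → ℝ) : Prop :=
  ∀ (x : R2) (n : Fin 2 → ℤ), f (x + fun i => (n i : ℝ)) = f x

/-- The Euclidean norm on `ℝ²`. -/
def en2 (z : R2) : ℝ := Real.sqrt (∑ i, z i ^ 2)

/-- `|∇f(x)|²`, the squared Euclidean norm of the gradient. -/
def gradNormSq (f : R2 → ℝ) (x : R2) : ℝ :=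
  ∑ j, (fderiv ℝ f x (Pi.single j 1)) ^ 2

/-- `|∇f(x)|`, the Euclidean norm of the gradient. -/
def gradNorm (f : R2 → ℝ) (x : R2) : ℝ := Real.sqrt (gradNormSq f x)

/-- The supremum norm `‖f‖_∞`. -/
def supNorm (f : R2 → ℝ) : ℝ := ⨆ x : R2, |f x|

/-- The squared homogeneous `H^{1/2}` seminorm on the torus (real-space formula). -/
def H12 (f : R2 → ℝ) : ℝ :=
  (1 / (4 * π)) * ∫ x in cube, ∫ z : R2, (f (x + z) - f x) ^ 2 / en2 z ^ 3


open scoped ENNReal Pointwise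

lemma cube_meas : MeasurableSet cube :=
  MeasurableSet.univ_pi fun _ => measurableSet_Ico

lemma shift_aux (g : R2 → ℝ≥0∞)
    (hper : ∀ (x : R2) (n : Fin 2 → ℤ), g (x + fun i => (n i : ℝ)) = g x) (z : R2) :
    ∫⁻ x in cube, g (x + z) = ∫⁻ x in cube, g x := by
  have h1 := ZSpan.isAddFundamentalDomain' (Pi.basisFun ℝ (Fin 2)) volume
  rw [ZSpan.fundamentalDomain_pi_basisFun] at h1
  have h2 := h1.vadd_of_comm z
  have hmp : MeasurePreserving (fun x : R2 => z + x) volume volume :=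
    measurePreserving_add_left volume z
  have e1 : ∫⁻ x in cube, g (x + z) = ∫⁻ x in (z +ᵥ cube), g x := by
    have := hmp.setLIntegral_comp_emb (measurableEmbedding_addLeft z) g cube
    simp only [add_comm z] at this
    rw [this]
    congr 2
    ext y
    simp only [Set.mem_image, Set.mem_vadd_set, vadd_eq_add, add_comm]
  rw [e1]
  have : Countable (Submodule.span ℤ (Set.range (Pi.basisFun ℝ (Fin 2)))).toAddSubgroup :=
    inferInstanceAs (Countable (Submodule.span ℤ (Set.range (Pi.basisFun ℝ (Fin 2)))))
  refine h2.setLIntegral_eq h1 g ?_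
  rintro ⟨v, hv⟩ x
  have hv' : v ∈ Submodule.span ℤ (Set.range (Pi.basisFun ℝ (Fin 2))) := hv
  rw [Module.Basis.mem_span_iff_repr_mem] at hv'
  choose n hn using hv'
  have : v = fun i => (n i : ℝ) := by
    ext i; simpa using (hn i).symm
  change g (v + x) = g x
  rw [this, add_comm]; exact hper x n

lemma diff_aux (f : R2 → ℝ) (hf : ContDiff ℝ (⊤ : ℕ∞) f) (hper : Per f)
    (φ : ℝ → ℝ) (hφ : ConvexOn ℝ Set.univ φ) (hc : Continuous φ) (h0 : ∀ x, 0 ≤ φ x) (z : R2) :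
    ∫⁻ x in cube, ENNReal.ofReal (φ (f (x + z) - f x)) ≤
      ∫⁻ x in cube, ENNReal.ofReal (φ (fderiv ℝ f x z)) := by
  have hdf : Continuous (fderiv ℝ f) := hf.continuous_fderiv (by simp)
  have hd : Differentiable ℝ f := hf.differentiable (by simp)
  have hdper : ∀ (x : R2) (n : Fin 2 → ℤ), fderiv ℝ f (x + fun i => (n i : ℝ)) = fderiv ℝ f x := by
    intro x n
    have : (fun y => f (y + fun i => (n i : ℝ))) = f := funext fun y => hper y n
    rw [← fderiv_comp_add_right, this]
  have key : ∀ x, ENNReal.ofReal (φ (f (x + z) - f x)) ≤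
      ∫⁻ t in Set.Ioc (0:ℝ) 1, ENNReal.ofReal (φ (fderiv ℝ f (x + t • z) z)) := by
    intro x
    have hcont : Continuous (fun t : ℝ => fderiv ℝ f (x + t • z) z) := by fun_prop
    have e : f (x + z) - f x = ∫ t in Set.Ioc (0:ℝ) 1, fderiv ℝ f (x + t • z) z := by
      rw [← intervalIntegral.integral_of_le zero_le_one]
      have := intervalIntegral.integral_eq_sub_of_hasDerivAt (a := (0:ℝ)) (b := 1)
        (f := fun t : ℝ => f (x + t • z)) (f' := fun t => fderiv ℝ f (x + t • z) z)
        (fun t _ => by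
          have h1 : HasDerivAt (fun t : ℝ => x + t • z) z t := by
            simpa using ((hasDerivAt_id t).smul_const z).const_add x
          exact (hd (x + t • z)).hasFDerivAt.comp_hasDerivAt t h1)
        (hcont.intervalIntegrable _ _)
      rw [this]; simp
    have : IsProbabilityMeasure (volume.restrict (Set.Ioc (0:ℝ) 1)) := ⟨by simp⟩
    have hi : Integrable (fun t : ℝ => fderiv ℝ f (x + t • z) z)
        (volume.restrict (Set.Ioc (0:ℝ) 1)) :=
      (hcont.integrableOn_Icc).mono_set Set.Ioc_subset_Icc_self
    have hi2 : Integrable (fun t : ℝ => φ (fderiv ℝ f (x + t • z) z))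
        (volume.restrict (Set.Ioc (0:ℝ) 1)) :=
      ((hc.comp hcont).integrableOn_Icc).mono_set Set.Ioc_subset_Icc_self
    rw [← ofReal_integral_eq_lintegral_ofReal hi2 (Filter.Eventually.of_forall fun _ => h0 _), e]
    exact ENNReal.ofReal_le_ofReal
      (hφ.map_integral_le hc.continuousOn isClosed_univ (by simp) hi hi2)
  calc _ ≤ ∫⁻ x in cube, ∫⁻ t in Set.Ioc (0:ℝ) 1,
        ENNReal.ofReal (φ (fderiv ℝ f (x + t • z) z)) := lintegral_mono key
    _ = ∫⁻ t in Set.Ioc (0:ℝ) 1, ∫⁻ x in cube,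
        ENNReal.ofReal (φ (fderiv ℝ f (x + t • z) z)) := by
      apply lintegral_lintegral_swap
      apply Measurable.aemeasurable
      apply Continuous.measurable
      simp only [Function.uncurry_def]
      exact ENNReal.continuous_ofReal.comp (by fun_prop)
    _ = ∫⁻ t in Set.Ioc (0:ℝ) 1, ∫⁻ x in cube, ENNReal.ofReal (φ (fderiv ℝ f x z)) := by
      refine lintegral_congr fun t => ?_
      exact shift_aux (fun x => ENNReal.ofReal (φ (fderiv ℝ f x z)))
        (fun x n => by simp only [hdper]) (t • z)
    _ = _ := by simp

lemma en2_polar (ρ θ : ℝ) (h : 0 < ρ) : en2 ![ρ * cos θ, ρ * sin θ] = ρ := by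
  simp only [en2, Fin.sum_univ_two, Matrix.cons_val_zero, Matrix.cons_val_one]
  rw [show (ρ * cos θ)^2 + (ρ * sin θ)^2 = ρ^2 by
    rw [mul_pow, mul_pow, ← mul_add, cos_sq_add_sin_sq, mul_one]]
  exact Real.sqrt_sq h.le

lemma en2_cont : Continuous en2 := by unfold en2; fun_prop

lemma polar_aux (S : Set ℝ) (hS : MeasurableSet S) (F : R2 → ℝ≥0∞) (k v : ℝ → ℝ≥0∞)
    (hk : Measurable k) (hv : Measurable v)
    (h : ∀ ρ θ, 0 < ρ → F ![ρ * cos θ, ρ * sin θ] = k ρ * v θ) :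
    ∫⁻ z in en2 ⁻¹' S, F z =
      (∫⁻ ρ in Set.Ioi 0 ∩ S, ENNReal.ofReal ρ * k ρ) * ∫⁻ θ in Set.Ioo (-π) π, v θ := by
  have hA : MeasurableSet (en2 ⁻¹' S) := en2_cont.measurable hS
  rw [← lintegral_indicator hA]
  have e1 := (volume_preserving_finTwoArrow ℝ).symm.lintegral_comp_emb
    (MeasurableEquiv.finTwoArrow (α := ℝ)).symm.measurableEmbedding ((en2 ⁻¹' S).indicator F)
  rw [← e1, ← lintegral_comp_polarCoord_symm]
  have e2 : ∀ p ∈ polarCoord.target, ENNReal.ofReal p.1 • (en2 ⁻¹' S).indicator F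
      ((MeasurableEquiv.finTwoArrow (α := ℝ)).symm (polarCoord.symm p)) =
      (S.indicator (fun ρ => ENNReal.ofReal ρ * k ρ) p.1) * v p.2 := by
    rintro ⟨ρ, θ⟩ hp
    have hρ : 0 < ρ := hp.1
    have e3 : (MeasurableEquiv.finTwoArrow (α := ℝ)).symm (polarCoord.symm (ρ, θ)) =
      ![ρ * cos θ, ρ * sin θ] := by
      ext i; fin_cases i <;> rfl
    rw [e3]
    by_cases hm : ρ ∈ S
    · have : ![ρ * cos θ, ρ * sin θ] ∈ en2 ⁻¹' S := by
        simpa [en2_polar ρ θ hρ] using hm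
      rw [Set.indicator_of_mem this, Set.indicator_of_mem hm, h ρ θ hρ, smul_eq_mul, mul_assoc]
    · have : ![ρ * cos θ, ρ * sin θ] ∉ en2 ⁻¹' S := by
        simpa [en2_polar ρ θ hρ] using hm
      rw [Set.indicator_of_notMem this, Set.indicator_of_notMem hm]; simp
  rw [setLIntegral_congr_fun polarCoord.open_target.measurableSet e2, polarCoord_target,
    Measure.volume_eq_prod, ← Measure.prod_restrict, lintegral_prod_mul]
  · rw [lintegral_indicator hS, Measure.restrict_restrict hS, Set.inter_comm]
  · exact ((ENNReal.measurable_ofReal.mul hk).indicator hS).aemeasurable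
  · exact hv.aemeasurable

lemma angle_sq (a b : ℝ) :
    ∫⁻ θ in Set.Ioo (-π) π, ENNReal.ofReal ((cos θ * a + sin θ * b) ^ 2) =
      ENNReal.ofReal (π * (a ^ 2 + b ^ 2)) := by
  have hc : Continuous fun θ : ℝ => (cos θ * a + sin θ * b) ^ 2 := by fun_prop
  rw [← ofReal_integral_eq_lintegral_ofReal
    ((hc.integrableOn_Icc).mono_set Set.Ioo_subset_Icc_self)
    (Filter.Eventually.of_forall fun _ => sq_nonneg _)]
  congr 1
  rw [← integral_Ioc_eq_integral_Ioo, ← intervalIntegral.integral_of_le (by linarith [pi_pos])]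
  have : (fun θ : ℝ => (cos θ * a + sin θ * b) ^ 2) =
      fun θ => a ^ 2 * cos θ ^ 2 + (2 * a * b) * (sin θ * cos θ) + b ^ 2 * sin θ ^ 2 := by
    ext θ; ring
  rw [this, intervalIntegral.integral_add, intervalIntegral.integral_add,
    intervalIntegral.integral_const_mul, intervalIntegral.integral_const_mul,
    intervalIntegral.integral_const_mul, integral_cos_sq, integral_sin_sq, integral_sin_mul_cos₁]
  · simp; ring
  all_goals exact Continuous.intervalIntegrable (by fun_prop) _ _

lemma abs_cos_int : ∫ θ in (-(π/2))..(-(π/2) + 2 * π), |cos θ| = 4 := by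
  have hi : ∀ a b : ℝ, IntervalIntegrable (fun θ => |cos θ|) volume a b := fun a b =>
    Continuous.intervalIntegrable (by fun_prop) _ _
  rw [← intervalIntegral.integral_add_adjacent_intervals (hi _ (π/2)) (hi _ _)]
  have h1 : ∫ θ in (-(π/2))..(π/2), |cos θ| = ∫ θ in (-(π/2))..(π/2), cos θ := by
    apply intervalIntegral.integral_congr
    intro θ hθ
    rw [Set.uIcc_of_le (by linarith [pi_pos])] at hθ
    exact abs_of_nonneg (cos_nonneg_of_mem_Icc hθ)
  have h2 : ∫ θ in (π/2)..(-(π/2) + 2 * π), |cos θ| =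
      ∫ θ in (π/2)..(-(π/2) + 2 * π), - cos θ := by
    apply intervalIntegral.integral_congr
    intro θ hθ
    rw [Set.uIcc_of_le (by linarith [pi_pos])] at hθ
    exact abs_of_nonpos (cos_nonpos_of_pi_div_two_le_of_le hθ.1 (by linarith [hθ.2]))
  rw [h1, h2, intervalIntegral.integral_neg, integral_cos, integral_cos, sin_add_two_pi]
  simp; norm_num

lemma angle_abs (a b : ℝ) :
    ∫⁻ θ in Set.Ioo (-π) π, ENNReal.ofReal |cos θ * a + sin θ * b| =
      ENNReal.ofReal (4 * √(a ^ 2 + b ^ 2)) := by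
  have hc : Continuous fun θ : ℝ => |cos θ * a + sin θ * b| := by fun_prop
  rw [← ofReal_integral_eq_lintegral_ofReal
    ((hc.integrableOn_Icc).mono_set Set.Ioo_subset_Icc_self)
    (Filter.Eventually.of_forall fun _ => abs_nonneg _)]
  congr 1
  rw [← integral_Ioc_eq_integral_Ioo, ← intervalIntegral.integral_of_le (by linarith [pi_pos])]
  set c : ℂ := ⟨a, b⟩ with hcdef
  have hn : ‖c‖ = √(a ^ 2 + b ^ 2) := by
    rw [Complex.norm_def, Complex.normSq_apply]; congr 1; simp [hcdef]; ring
  have h1 : ‖c‖ * cos c.arg = a := Complex.norm_mul_cos_arg c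
  have h2 : ‖c‖ * sin c.arg = b := Complex.norm_mul_sin_arg c
  have : (fun θ : ℝ => |cos θ * a + sin θ * b|) = fun θ => ‖c‖ * |cos (θ - c.arg)| := by
    ext θ
    have : cos θ * a + sin θ * b = ‖c‖ * cos (θ - c.arg) := by
      rw [cos_sub]
      linear_combination -cos θ * h1 - sin θ * h2
    rw [this, abs_mul, abs_of_nonneg (norm_nonneg c)]
  rw [this, intervalIntegral.integral_const_mul,
    intervalIntegral.integral_comp_sub_right (fun θ => |cos θ|)]
  have hp : Function.Periodic (fun θ => |cos θ|) (2 * π) := fun θ => by simp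
  have h3 := hp.intervalIntegral_add_eq (-π - c.arg) (-(π/2))
  rw [show π - c.arg = -π - c.arg + 2 * π by ring, h3, abs_cos_int, hn]; ring

def K (z : R2) : ℝ≥0∞ := ENNReal.ofReal ((en2 z ^ 3)⁻¹)

lemma K_meas : Measurable K :=
  ENNReal.measurable_ofReal.comp ((en2_cont.measurable.pow_const 3).inv)

lemma near_int (a b r : ℝ) :
    ∫⁻ z in en2 ⁻¹' Set.Iio r, K z * ENNReal.ofReal ((z 0 * a + z 1 * b) ^ 2) =
      ENNReal.ofReal (r * (π * (a ^ 2 + b ^ 2))) := by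
  rw [polar_aux (Set.Iio r) measurableSet_Iio _ (fun ρ => ENNReal.ofReal ρ⁻¹)
    (fun θ => ENNReal.ofReal ((cos θ * a + sin θ * b) ^ 2)) (by fun_prop) (by fun_prop), angle_sq,
    ENNReal.ofReal_mul' (p := r) (by positivity)]
  · congr 1
    rw [setLIntegral_congr_fun (g := fun _ => 1)
      (measurableSet_Ioi.inter measurableSet_Iio)]
    · rw [Set.Ioi_inter_Iio]; simp
    · intro ρ hρ
      have h : 0 < ρ := hρ.1
      simp only
      rw [← ENNReal.ofReal_mul h.le, mul_inv_cancel₀ h.ne', ENNReal.ofReal_one]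
  · intro ρ θ h
    simp only [K, en2_polar ρ θ h, Matrix.cons_val_zero, Matrix.cons_val_one]
    rw [← ENNReal.ofReal_mul (by positivity), ← ENNReal.ofReal_mul (by positivity)]
    congr 1
    field_simp

lemma mid_int (a b r R : ℝ) (hr : 0 < r) (hR : r ≤ R) :
    ∫⁻ z in en2 ⁻¹' Set.Ico r R, K z * ENNReal.ofReal |z 0 * a + z 1 * b| =
      ENNReal.ofReal (log (R / r) * (4 * √(a ^ 2 + b ^ 2))) := by
  rw [polar_aux (Set.Ico r R) measurableSet_Ico _ (fun ρ => ENNReal.ofReal (ρ ^ 2)⁻¹)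
    (fun θ => ENNReal.ofReal |cos θ * a + sin θ * b|) (by fun_prop) (by fun_prop), angle_abs,
    ENNReal.ofReal_mul' (p := log (R / r)) (by positivity)]
  · congr 1
    rw [setLIntegral_congr_fun (g := fun ρ => ENNReal.ofReal ρ⁻¹)
      (measurableSet_Ioi.inter measurableSet_Ico)]
    · rw [show Set.Ioi 0 ∩ Set.Ico r R = Set.Ico r R from
        Set.inter_eq_right.2 fun x hx => hr.trans_le hx.1]
      have hco : ContinuousOn (fun x : ℝ => x⁻¹) (Set.Icc r R) :=
        continuousOn_inv₀.mono fun x hx => (hr.trans_le hx.1).ne'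
      have hint : Integrable (fun x : ℝ => x⁻¹) (volume.restrict (Set.Ico r R)) :=
        IntegrableOn.mono_set hco.integrableOn_Icc Set.Ico_subset_Icc_self
      have hnn : 0 ≤ᵐ[volume.restrict (Set.Ico r R)] fun x : ℝ => x⁻¹ := by
        filter_upwards [ae_restrict_mem measurableSet_Ico] with x hx
        exact (inv_pos.2 (hr.trans_le hx.1)).le
      rw [← ofReal_integral_eq_lintegral_ofReal hint hnn, integral_Ico_eq_integral_Ioc,
        ← intervalIntegral.integral_of_le hR, integral_inv_of_pos hr (hr.trans_le hR)]
    · intro ρ hρ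
      have h : 0 < ρ := hρ.1
      simp only
      rw [← ENNReal.ofReal_mul h.le]
      congr 1
      field_simp
  · intro ρ θ h
    simp only [K, en2_polar ρ θ h, Matrix.cons_val_zero, Matrix.cons_val_one]
    rw [← ENNReal.ofReal_mul (by positivity), ← ENNReal.ofReal_mul (by positivity)]
    congr 1
    rw [mul_assoc, mul_assoc, ← mul_add, abs_mul, abs_of_pos h]
    field_simp

lemma far_int (R : ℝ) (hR : 0 < R) :
    ∫⁻ z in en2 ⁻¹' Set.Ici R, K z = ENNReal.ofReal (1 / R * (2 * π)) := by
  rw [polar_aux (Set.Ici R) measurableSet_Ici _ (fun ρ => ENNReal.ofReal (ρ ^ 3)⁻¹)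
    (fun θ => 1) (by fun_prop) (by fun_prop), ENNReal.ofReal_mul' (by positivity)]
  · congr 1
    · rw [setLIntegral_congr_fun (g := fun ρ => ENNReal.ofReal (ρ ^ (-2 : ℝ)))
        (measurableSet_Ioi.inter measurableSet_Ici)]
      · rw [show Set.Ioi 0 ∩ Set.Ici R = Set.Ici R from
          Set.inter_eq_right.2 fun x hx => hR.trans_le hx]
        rw [setLIntegral_congr Ioi_ae_eq_Ici.symm, ← ofReal_integral_eq_lintegral_ofReal,
          integral_Ioi_rpow_of_lt (by norm_num) hR]
        · congr 1
          rw [show (-2 + 1 : ℝ) = -1 by norm_num, rpow_neg_one]; simp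
        · exact integrableOn_Ioi_rpow_of_lt (by norm_num) hR
        · filter_upwards [ae_restrict_mem measurableSet_Ioi] with x hx
          exact rpow_nonneg (hR.trans hx).le _
      · intro ρ hρ
        have h : 0 < ρ := hρ.1
        simp only
        rw [← ENNReal.ofReal_mul h.le, rpow_neg h.le, rpow_ofNat]
        congr 1
        field_simp
    · rw [lintegral_one, Measure.restrict_apply_univ, Real.volume_Ioo]; congr 1; ring
  · intro ρ θ h
    simp only [K, en2_polar ρ θ h, mul_one]

lemma f_bdd (f : R2 → ℝ) (hf : Continuous f) (hper : Per f) (x : R2) : |f x| ≤ supNorm f := by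
  have hb : BddAbove (Set.range fun x => |f x|) := by
    obtain ⟨B, hB⟩ := (isCompact_univ_pi (fun _ : Fin 2 => isCompact_Icc (a := (0:ℝ)) (b := 1))).bddAbove_image
      (f := fun x => |f x|) (by fun_prop)
    refine ⟨B, ?_⟩
    rintro _ ⟨y, rfl⟩
    have e : f y = f (fun i => Int.fract (y i)) := by
      have := hper (fun i => Int.fract (y i)) (fun i => ⌊y i⌋)
      rw [← this]; congr 1; ext i; simp
    simp only [e]
    apply hB
    exact ⟨_, fun i _ => ⟨Int.fract_nonneg _, (Int.fract_lt_one _).le⟩, rfl⟩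
  exact le_ciSup hb x

lemma fderiv_coord (f : R2 → ℝ) (x z : R2) :
    fderiv ℝ f x z = z 0 * fderiv ℝ f x (Pi.single 0 1) + z 1 * fderiv ℝ f x (Pi.single 1 1) := by
  have : z = z 0 • Pi.single 0 1 + z 1 • Pi.single 1 1 := by
    ext i; fin_cases i <;> simp
  conv_lhs => rw [this]
  simp

lemma swapK (A : Set R2) (h : R2 → R2 → ℝ≥0∞) (hm : Measurable (Function.uncurry h)) :
    ∫⁻ z in A, K z * ∫⁻ x in cube, h x z = ∫⁻ x in cube, ∫⁻ z in A, K z * h x z := by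
  rw [lintegral_lintegral_swap]
  · refine lintegral_congr fun z => ?_
    rw [lintegral_const_mul]
    exact hm.comp (measurable_id.prodMk measurable_const)
  · exact ((K_meas.comp measurable_snd).mul hm).aemeasurable

lemma gradNormSq_eq (f : R2 → ℝ) (x : R2) : gradNormSq f x =
    fderiv ℝ f x (Pi.single 0 1) ^ 2 + fderiv ℝ f x (Pi.single 1 1) ^ 2 := by
  simp [gradNormSq, Fin.sum_univ_two]

lemma gradNormSq_cont (f : R2 → ℝ) (hf : ContDiff ℝ (⊤ : ℕ∞) f) : Continuous (gradNormSq f) := by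
  have hdf : Continuous (fderiv ℝ f) := hf.continuous_fderiv (by simp)
  unfold gradNormSq; fun_prop

lemma cube_int (g : R2 → ℝ) (hg : Continuous g) : IntegrableOn g cube := by
  have hK : IsCompact (Set.univ.pi (fun _ : Fin 2 => Set.Icc (0:ℝ) 1)) :=
    isCompact_univ_pi (fun _ => isCompact_Icc)
  refine (hg.continuousOn.integrableOn_compact hK).mono_set ?_
  exact Set.pi_mono fun i _ => Set.Ico_subset_Icc_self

lemma cube_vol : volume cube = 1 := by
  simp [cube, volume_pi_pi]

lemma near_bd (f : R2 → ℝ) (hf : ContDiff ℝ (⊤ : ℕ∞) f) (hper : Per f) (r : ℝ) (hr : 0 < r) :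
    ∫⁻ z in en2 ⁻¹' Set.Iio r, K z * ∫⁻ x in cube, ENNReal.ofReal ((f (x + z) - f x) ^ 2) ≤
      ENNReal.ofReal (r * π * ∫ x in cube, gradNormSq f x) := by
  have hdf : Continuous (fderiv ℝ f) := hf.continuous_fderiv (by simp)
  calc _ ≤ ∫⁻ z in en2 ⁻¹' Set.Iio r, K z * ∫⁻ x in cube, ENNReal.ofReal ((fderiv ℝ f x z) ^ 2) := by
        refine lintegral_mono fun z => ?_
        dsimp only
        gcongr 1
        exact diff_aux f hf hper (fun t => t ^ 2) (even_two.convexOn_pow) (by fun_prop)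
          (fun _ => sq_nonneg _) z
    _ = ∫⁻ x in cube, ∫⁻ z in en2 ⁻¹' Set.Iio r, K z * ENNReal.ofReal ((fderiv ℝ f x z) ^ 2) := by
        apply swapK
        apply ENNReal.measurable_ofReal.comp
        apply Continuous.measurable
        fun_prop
    _ = ∫⁻ x in cube, ENNReal.ofReal (r * π * gradNormSq f x) := by
        refine lintegral_congr fun x => ?_
        rw [gradNormSq_eq, mul_assoc, ← near_int]
        exact lintegral_congr fun z => by rw [fderiv_coord f x z]
    _ = _ := by
        rw [← ofReal_integral_eq_lintegral_ofReal, integral_const_mul]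
        · exact cube_int _ ((gradNormSq_cont f hf).const_mul _)
        · refine Filter.Eventually.of_forall fun x => ?_
          have : 0 ≤ gradNormSq f x := by rw [gradNormSq_eq]; positivity
          have := pi_pos
          simp only [Pi.zero_apply]; positivity

lemma gradNorm_cont (f : R2 → ℝ) (hf : ContDiff ℝ (⊤ : ℕ∞) f) : Continuous (gradNorm f) :=
  (gradNormSq_cont f hf).sqrt

lemma sq_bd (f : R2 → ℝ) (hf : Continuous f) (hper : Per f) (z : R2) :
    ∫⁻ x in cube, ENNReal.ofReal ((f (x + z) - f x) ^ 2) ≤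
      ENNReal.ofReal (2 * supNorm f) * ∫⁻ x in cube, ENNReal.ofReal |f (x + z) - f x| := by
  have hM : 0 ≤ supNorm f := (abs_nonneg _).trans (f_bdd f hf hper 0)
  rw [← lintegral_const_mul _ (by fun_prop)]
  refine lintegral_mono fun x => ?_
  dsimp only
  rw [← ENNReal.ofReal_mul (by positivity)]
  apply ENNReal.ofReal_le_ofReal
  rw [← sq_abs, sq]
  gcongr
  have := abs_sub (f (x + z)) (f x)
  linarith [f_bdd f hf hper (x + z), f_bdd f hf hper x]

lemma mid_bd (f : R2 → ℝ) (hf : ContDiff ℝ (⊤ : ℕ∞) f) (hper : Per f) (r R : ℝ) (hr : 0 < r)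
    (hR : r ≤ R) :
    ∫⁻ z in en2 ⁻¹' Set.Ico r R, K z * ∫⁻ x in cube, ENNReal.ofReal ((f (x + z) - f x) ^ 2) ≤
      ENNReal.ofReal (2 * supNorm f * (log (R / r) * 4 * ∫ x in cube, gradNorm f x)) := by
  have hdf : Continuous (fderiv ℝ f) := hf.continuous_fderiv (by simp)
  have hM : 0 ≤ supNorm f := (abs_nonneg _).trans (f_bdd f hf.continuous hper 0)
  have hl : 0 ≤ log (R / r) := log_nonneg (by rwa [le_div_iff₀ hr, one_mul])
  have hmeas : Measurable (Function.uncurry fun x z : R2 => ENNReal.ofReal |fderiv ℝ f x z|) := by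
    apply ENNReal.measurable_ofReal.comp
    apply Continuous.measurable
    fun_prop
  calc _ ≤ ∫⁻ z in en2 ⁻¹' Set.Ico r R, ENNReal.ofReal (2 * supNorm f) *
          (K z * ∫⁻ x in cube, ENNReal.ofReal |fderiv ℝ f x z|) := by
        refine lintegral_mono fun z => ?_
        dsimp only
        rw [mul_left_comm]
        gcongr 1
        refine (sq_bd f hf.continuous hper z).trans ?_
        gcongr 1
        exact diff_aux f hf hper (fun t => |t|) (convexOn_norm convex_univ) (by fun_prop)
          (fun _ => abs_nonneg _) z
    _ = ENNReal.ofReal (2 * supNorm f) * ∫⁻ x in cube, ∫⁻ z in en2 ⁻¹' Set.Ico r R,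
          K z * ENNReal.ofReal |fderiv ℝ f x z| := by
        rw [lintegral_const_mul' _ _ ENNReal.ofReal_ne_top, swapK _ _ hmeas]
    _ = ENNReal.ofReal (2 * supNorm f) * ∫⁻ x in cube,
          ENNReal.ofReal (log (R / r) * 4 * gradNorm f x) := by
        congr 1
        refine lintegral_congr fun x => ?_
        rw [gradNorm, gradNormSq_eq, mul_assoc, ← mid_int _ _ _ _ hr hR]
        exact lintegral_congr fun z => by rw [fderiv_coord f x z]
    _ = _ := by
        rw [← ofReal_integral_eq_lintegral_ofReal, integral_const_mul,
          ← ENNReal.ofReal_mul (by positivity)]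
        · exact cube_int _ ((gradNorm_cont f hf).const_mul _)
        · refine Filter.Eventually.of_forall fun x => ?_
          have : 0 ≤ gradNorm f x := Real.sqrt_nonneg _
          simp only [Pi.zero_apply]; positivity

lemma far_pt (f : R2 → ℝ) (hf : ContDiff ℝ (⊤ : ℕ∞) f) (hper : Per f) (z : R2) :
    ∫⁻ x in cube, ENNReal.ofReal |f (x + z) - f x| ≤
      ENNReal.ofReal (min (2 * supNorm f) (2 * ∫ x in cube, gradNorm f x)) := by
  have hM : 0 ≤ supNorm f := (abs_nonneg _).trans (f_bdd f hf.continuous hper 0)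
  rcases min_choice (2 * supNorm f) (2 * ∫ x in cube, gradNorm f x) with h | h
  · rw [h]
    calc _ ≤ ∫⁻ x in cube, ENNReal.ofReal (2 * supNorm f) := by
          refine lintegral_mono fun x => ENNReal.ofReal_le_ofReal ?_
          have := abs_sub (f (x + z)) (f x)
          linarith [f_bdd f hf.continuous hper (x + z), f_bdd f hf.continuous hper x]
      _ = _ := by rw [setLIntegral_const, cube_vol, mul_one]
  · rw [h]
    set y : R2 := fun i => Int.fract (z i) with hy
    have e : ∀ x, f (x + z) = f (x + y) := by
      intro x
      rw [← hper (x + y) (fun i => ⌊z i⌋)]; congr 1; ext i; simp [hy, add_assoc]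
    simp_rw [e]
    refine (diff_aux f hf hper (fun t => |t|) (convexOn_norm convex_univ) (by fun_prop)
          (fun _ => abs_nonneg _) y).trans ?_
    rw [← integral_const_mul, ofReal_integral_eq_lintegral_ofReal]
    · refine lintegral_mono fun x => ENNReal.ofReal_le_ofReal ?_
      rw [fderiv_coord, gradNorm, gradNormSq_eq]
      set a := fderiv ℝ f x (Pi.single 0 1)
      set b := fderiv ℝ f x (Pi.single 1 1)
      have ha : |a| ≤ √(a ^ 2 + b ^ 2) := Real.abs_le_sqrt (by nlinarith [sq_nonneg b])
      have hb : |b| ≤ √(a ^ 2 + b ^ 2) := Real.abs_le_sqrt (by nlinarith [sq_nonneg a])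
      have hy' : ∀ i, |y i| ≤ 1 := fun i => by
        rw [abs_of_nonneg (Int.fract_nonneg _)]; exact (Int.fract_lt_one _).le
      calc |y 0 * a + y 1 * b| ≤ |y 0 * a| + |y 1 * b| := abs_add_le _ _
        _ = |y 0| * |a| + |y 1| * |b| := by rw [abs_mul, abs_mul]
        _ ≤ 1 * |a| + 1 * |b| := by gcongr <;> exact hy' _
        _ ≤ _ := by linarith
    · exact cube_int _ ((gradNorm_cont f hf).const_mul _)
    · refine Filter.Eventually.of_forall fun x => ?_
      have : 0 ≤ gradNorm f x := Real.sqrt_nonneg _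
      simp only [Pi.zero_apply]; positivity

lemma far_bd (f : R2 → ℝ) (hf : ContDiff ℝ (⊤ : ℕ∞) f) (hper : Per f) (R : ℝ) (hR : 0 < R) :
    ∫⁻ z in en2 ⁻¹' Set.Ici R, K z * ∫⁻ x in cube, ENNReal.ofReal ((f (x + z) - f x) ^ 2) ≤
      ENNReal.ofReal ((1 / R * (2 * π)) *
        (2 * supNorm f * min (2 * supNorm f) (2 * ∫ x in cube, gradNorm f x))) := by
  have hM : 0 ≤ supNorm f := (abs_nonneg _).trans (f_bdd f hf.continuous hper 0)
  calc _ ≤ ∫⁻ z in en2 ⁻¹' Set.Ici R, K z * ENNReal.ofReal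
        (2 * supNorm f * min (2 * supNorm f) (2 * ∫ x in cube, gradNorm f x)) := by
        refine lintegral_mono fun z => ?_
        dsimp only
        gcongr 1
        refine (sq_bd f hf.continuous hper z).trans ?_
        rw [ENNReal.ofReal_mul (p := 2 * supNorm f) (by positivity)]
        gcongr 1
        exact far_pt f hf hper z
    _ = _ := by
        have := pi_pos
        rw [lintegral_mul_const _ K_meas, far_int R hR, ← ENNReal.ofReal_mul (by positivity)]

lemma H12_bd (f : R2 → ℝ) (hf : ContDiff ℝ (⊤ : ℕ∞) f) (hper : Per f) (r R : ℝ) (hr : 0 < r)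
    (hR : r ≤ R) :
    H12 f ≤ 1 / (4 * π) * (r * π * (∫ x in cube, gradNormSq f x) +
      2 * supNorm f * (log (R / r) * 4 * ∫ x in cube, gradNorm f x) +
      (1 / R * (2 * π)) *
        (2 * supNorm f * min (2 * supNorm f) (2 * ∫ x in cube, gradNorm f x))) := by
  have hpi := pi_pos
  have hM : 0 ≤ supNorm f := (abs_nonneg _).trans (f_bdd f hf.continuous hper 0)
  have hl : 0 ≤ log (R / r) := log_nonneg (by rwa [le_div_iff₀ hr, one_mul])
  have hR0 : 0 < R := hr.trans_le hR
  have hG : 0 ≤ ∫ x in cube, gradNorm f x := integral_nonneg fun x => Real.sqrt_nonneg _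
  have hQ : 0 ≤ ∫ x in cube, gradNormSq f x := integral_nonneg fun x => by
    simp only [Pi.zero_apply]; rw [gradNormSq_eq]; positivity
  have hfc := hf.continuous
  unfold H12
  gcongr
  have hmin : 0 ≤ min (2 * supNorm f) (2 * ∫ x in cube, gradNorm f x) := by positivity
  refine (Real.le_norm_self _).trans ?_
  rw [← ENNReal.ofReal_le_ofReal_iff (by positivity), ofReal_norm]
  refine (enorm_integral_le_lintegral_enorm _).trans ?_
  calc _ ≤ ∫⁻ x in cube, ∫⁻ z, K z * ENNReal.ofReal ((f (x + z) - f x) ^ 2) := by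
        refine lintegral_mono fun x => (enorm_integral_le_lintegral_enorm _).trans ?_
        refine lintegral_mono fun z => le_of_eq ?_
        have : 0 ≤ en2 z := Real.sqrt_nonneg _
        dsimp only
        rw [Real.enorm_of_nonneg (by positivity), K, ← ENNReal.ofReal_mul (by positivity)]
        congr 1; rw [div_eq_inv_mul]
    _ = ∫⁻ z, K z * ∫⁻ x in cube, ENNReal.ofReal ((f (x + z) - f x) ^ 2) := by
        have := swapK Set.univ (fun x z => ENNReal.ofReal ((f (x + z) - f x) ^ 2)) (by
          apply ENNReal.measurable_ofReal.comp
          apply Continuous.measurable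
          fun_prop)
        simp only [Measure.restrict_univ] at this
        exact this.symm
    _ = ∫⁻ z in (en2 ⁻¹' Set.Iio r ∪ en2 ⁻¹' Set.Ico r R) ∪ en2 ⁻¹' Set.Ici R,
          K z * ∫⁻ x in cube, ENNReal.ofReal ((f (x + z) - f x) ^ 2) := by
        rw [← setLIntegral_univ]
        congr 2
        rw [← Set.preimage_union, ← Set.preimage_union, Set.Iio_union_Ico_eq_Iio hR,
          Set.Iio_union_Ici, Set.preimage_univ]
    _ ≤ _ := by
        refine (lintegral_union_le _ _ _).trans ?_
        rw [ENNReal.ofReal_add (by positivity) (by positivity),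
          ENNReal.ofReal_add (by positivity) (by positivity)]
        refine add_le_add ((lintegral_union_le _ _ _).trans (add_le_add ?_ ?_)) ?_
        · exact near_bd f hf hper r hr
        · exact mid_bd f hf hper r R hr hR
        · exact far_bd f hf hper R hR0

/-- Lemma `le:main_ineq`: the key `H^{1/2}` bound. -/
theorem stmt_0 :
    ∃ c : ℝ, 1 ≤ c ∧
      ∀ f : R2 → ℝ, ContDiff ℝ (⊤ : ℕ∞) f → Per f →
        0 < (∫ x in cube, gradNorm f x) →
        ∀ ε : ℝ, 0 < ε →
          H12 f ≤ ε / 2 * (∫ x in cube, gradNormSq f x) +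
            2 / π *
              Real.log (c * max 1
                (min (supNorm f / (ε * ∫ x in cube, gradNorm f x)) (1 / ε))) *
              supNorm f * ∫ x in cube, gradNorm f x := by
  have hpi := pi_pos
  refine ⟨exp (π / 2), one_le_exp (by positivity), ?_⟩
  intro f hf hper hG ε hε
  have hM : 0 ≤ supNorm f := (abs_nonneg _).trans (f_bdd f hf.continuous hper 0)
  set G := ∫ x in cube, gradNorm f x
  set Q := ∫ x in cube, gradNormSq f x
  set M := supNorm f
  set L := max 1 (min (M / (ε * G)) (1 / ε)) with hL
  have hL1 : 1 ≤ L := le_max_left _ _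
  have hL0 : 0 < L := by linarith
  have hLm : min (M / (ε * G)) (1 / ε) ≤ L := le_max_right _ _
  have key := H12_bd f hf hper (2 * ε) (2 * ε * L) (by positivity)
    (le_mul_of_one_le_right (by positivity) hL1)
  rw [show 2 * ε * L / (2 * ε) = L by field_simp] at key
  rw [log_mul (exp_pos _).ne' hL0.ne', log_exp]
  refine key.trans ?_
  have hmin : min (2 * M) (2 * G) ≤ 2 * (ε * L * G) := by
    rcases min_le_iff.1 hLm with h | h
    · rw [div_le_iff₀ (by positivity)] at h
      exact (min_le_left _ _).trans (by nlinarith)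
    · rw [div_le_iff₀ hε] at h
      exact (min_le_right _ _).trans (by nlinarith)
  have hfar : 1 / (2 * ε * L) * (2 * π) * (2 * M * min (2 * M) (2 * G)) ≤ 4 * π * (M * G) := by
    calc _ ≤ 1 / (2 * ε * L) * (2 * π) * (2 * M * (2 * (ε * L * G))) := by gcongr
      _ = _ := by field_simp; ring
  calc _ ≤ 1 / (4 * π) * (2 * ε * π * Q + 2 * M * (log L * 4 * G) + 4 * π * (M * G)) := by
        gcongr
    _ = _ := by field_simp; ring
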